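/- arXiv:1403.2634 — 2 statements merged into one kernel-verified Lean document; each statement's English description precedes it below -/
import Mathlib

section
/- A solvable non-Abelian subgroup of Diff^ω₊(I) is never C₀-discrete. -/
open Set

namespace HeightHomeo

/-- The group of orientation-preserving homeomorphisms of a linearly ordered space,
modeled as order-automorphisms (for `I = [0,1]` these are exactly the
orientation-preserving homeomorphisms). -/
instance ordIsoGroup {α : Type*} [Preorder α] : Group (α ≃o α) where
  mul f g := g.trans f
  one := OrderIso.refl α
  inv := OrderIso.symm
  mul_assoc _ _ _ := rfl
  one_mul _ := rfl
  mul_one _ := rfl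
  inv_mul_cancel f := by ext x; exact f.symm_apply_apply x

/-- `Homeo₊(I)`: the group of orientation-preserving homeomorphisms of the closed
unit interval `I = [0,1]`. -/
abbrev HomeoI := unitInterval ≃o unitInterval

/-- The order-convex hull of a set of points of the unit interval. -/
def ordHull (S : Set unitInterval) : Set unitInterval :=
  {y | ∃ a ∈ S, ∃ b ∈ S, a ≤ y ∧ y ≤ b}

/-- `A` is an orbital of the homeomorphism `g`: the convex hull of the orbit of some
point of `I` under the cyclic subgroup `⟨g⟩`, provided it contains more than one point. -/
def IsOrbitalOf (g : HomeoI) (A : Set unitInterval) : Prop :=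
  ∃ x : unitInterval,
    A = ordHull (Set.range fun n : ℤ => (g ^ n) x) ∧ A.Nontrivial

/-- A tower of a subgroup `Γ ≤ Homeo₊(I)`: a set `T` of signed orbitals `(A, g)`
(with `g ∈ Γ` and `A` an orbital of `g`) whose orbitals form a chain under inclusion,
and containing exactly one signed orbital for each of the occurring orbitals. -/
def IsTower (Γ : Subgroup HomeoI) (T : Set (Set unitInterval × HomeoI)) : Prop :=
  (∀ p ∈ T, p.2 ∈ Γ ∧ IsOrbitalOf p.2 p.1) ∧
  (∀ p ∈ T, ∀ q ∈ T, p.1 ⊆ q.1 ∨ q.1 ⊆ p.1) ∧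
  (∀ p ∈ T, ∀ q ∈ T, p.1 = q.1 → p = q)

/-- The left endpoint of a set of points of the unit interval, as a real number. -/
noncomputable def leftEnd (A : Set unitInterval) : ℝ :=
  sInf ((fun x : unitInterval => (x : ℝ)) '' A)

/-- The right endpoint of a set of points of the unit interval, as a real number. -/
noncomputable def rightEnd (A : Set unitInterval) : ℝ :=
  sSup ((fun x : unitInterval => (x : ℝ)) '' A)

/-- Two intervals share an end if they have a common left endpoint or a common right
endpoint. -/
def ShareEnd (A B : Set unitInterval) : Prop :=
  leftEnd A = leftEnd B ∨ rightEnd A = rightEnd B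

/-- A tower is strict if no two distinct orbitals occurring in it share an end. -/
def IsStrictTower (Γ : Subgroup HomeoI) (T : Set (Set unitInterval × HomeoI)) : Prop :=
  IsTower Γ T ∧ ∀ p ∈ T, ∀ q ∈ T, p.1 ≠ q.1 → ¬ ShareEnd p.1 q.1

/-- The set of orbitals occurring in a tower. -/
def towerOrbitals (T : Set (Set unitInterval × HomeoI)) : Set (Set unitInterval) :=
  Prod.fst '' T

/-- The height `h(Γ)` of a subgroup of `Homeo₊(I)`: the supremum (in `ℕ∞`) of the
cardinalities of the sets of orbitals of its towers. -/
noncomputable def height (Γ : Subgroup HomeoI) : ℕ∞ :=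
  ⨆ T ∈ {T | IsTower Γ T}, (towerOrbitals T).encard

/-- The strict height `h_strict(Γ)` of a subgroup of `Homeo₊(I)`: the supremum (in
`ℕ∞`) of the cardinalities of the sets of orbitals of its strict towers. -/
noncomputable def strictHeight (Γ : Subgroup HomeoI) : ℕ∞ :=
  ⨆ T ∈ {T | IsStrictTower Γ T}, (towerOrbitals T).encard

/-- `f ∈ Diff^ω₊(I)`: `f` extends to a real-analytic map on a neighborhood of `[0,1]`
(being an order-automorphism of `[0,1]`, `f` is automatically strictly increasing and
fixes `0` and `1`). -/
def IsAnalytic (f : HomeoI) : Prop :=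
  ∃ F : ℝ → ℝ, (∀ x ∈ Set.Icc (0 : ℝ) 1, AnalyticAt ℝ F x) ∧
    ∀ x : unitInterval, F x = (f x : ℝ)

/-- A subgroup `Γ ≤ Homeo₊(I)` is `C⁰`-discrete if the identity is isolated in `Γ`
with respect to the metric `d(f,g) = sup_{x ∈ [0,1]} |f x - g x|`. -/
def C0Discrete (Γ : Subgroup HomeoI) : Prop :=
  ∃ ε > (0 : ℝ), ∀ f ∈ Γ, f ≠ 1 → ∃ x : unitInterval, ε ≤ |(f x : ℝ) - (x : ℝ)|

open Filter Topology Asymptotics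

section Dynamics

lemma mul_apply' (g h : HomeoI) (x : unitInterval) : (g * h) x = g (h x) := rfl

lemma one_apply' (x : unitInterval) : (1 : HomeoI) x = x := rfl

lemma inv_apply_self' (g : HomeoI) (x : unitInterval) : g⁻¹ (g x) = x := g.symm_apply_apply x

lemma apply_inv_self' (g : HomeoI) (x : unitInterval) : g (g⁻¹ x) = x := g.apply_symm_apply x

lemma commute_apply {g h : HomeoI} (hc : Commute g h) (x : unitInterval) : g (h x) = h (g x) :=
  DFunLike.congr_fun hc.eq x

lemma inv_fix {g : HomeoI} {x : unitInterval} (h : g x = x) : g⁻¹ x = x := by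
  conv_lhs => rw [← h]
  exact inv_apply_self' g x

lemma inv_fix_iff {g : HomeoI} {x : unitInterval} : g⁻¹ x = x ↔ g x = x :=
  ⟨fun h => by simpa using inv_fix h, inv_fix⟩

lemma pow_fix {g : HomeoI} {x : unitInterval} (h : g x = x) (n : ℕ) : (g ^ n) x = x := by
  induction n with
  | zero => rfl
  | succ n ih => rw [pow_succ, mul_apply', h, ih]

lemma zpow_fix {g : HomeoI} {x : unitInterval} (h : g x = x) (n : ℤ) : (g ^ n) x = x := by
  cases n with
  | ofNat n => simpa using pow_fix h n
  | negSucc n => rw [zpow_negSucc]; exact inv_fix (pow_fix h _)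

/-- An order automorphism preserving a finite set fixes it pointwise. -/
lemma fixes_of_finite {S : Set unitInterval} (hS : S.Finite) {h : HomeoI}
    (hh : ∀ x ∈ S, h x ∈ S) {x : unitInterval} (hx : x ∈ S) : h x = x := by
  rcases lt_trichotomy (h x) x with hlt | heq | hgt
  · have hT : {y ∈ S | h y < y}.Finite := hS.subset (Set.sep_subset _ _)
    obtain ⟨m, ⟨hm, hmlt⟩, hmin⟩ := Set.exists_min_image _ id hT ⟨x, hx, hlt⟩
    exact absurd (hmin (h m) ⟨hh m hm, h.strictMono hmlt⟩) (not_le.2 hmlt)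
  · exact heq
  · have hT : {y ∈ S | y < h y}.Finite := hS.subset (Set.sep_subset _ _)
    obtain ⟨m, ⟨hm, hmlt⟩, hmax⟩ := Set.exists_max_image _ id hT ⟨x, hx, hgt⟩
    exact absurd (hmax (h m) ⟨hh m hm, h.strictMono hmlt⟩) (not_le.2 hmlt)

lemma fix_of_commute {g z : HomeoI} (hz : {x | z x = x}.Finite) (hc : Commute g z)
    {x : unitInterval} (hx : z x = x) : g x = x :=
  fixes_of_finite hz (h := g)
    (fun y hy => show z (g y) = g y by rw [← commute_apply hc, show z y = y from hy]) hx

/-- If `h` fixes every fixed point of `g`, then `g` moves `x` and `h x` in the same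
direction. -/
lemma lt_apply_of_lt {g h : HomeoI} (hfix : ∀ y, g y = y → h y = y) {x : unitInterval}
    (hx : x < g x) : h x < g (h x) := by
  by_contra! hle
  obtain ⟨w, hw, hgw⟩ := (isPreconnected_uIcc (a := x) (b := h x)).intermediate_value₂
    left_mem_uIcc right_mem_uIcc continuous_id.continuousOn g.continuous.continuousOn hx.le hle
  have hgw' : g w = w := hgw.symm
  have hhw := hfix w hgw'
  have hne : x ≠ w := by rintro rfl; exact hx.ne hgw
  rcases lt_or_gt_of_ne hne with hlt | hlt
  · have h1 := h.strictMono hlt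
    rw [hhw] at h1
    rcases Set.mem_uIcc.1 hw with h2 | h2
    · exact absurd h2.2 (not_le.2 h1)
    · exact absurd h2.2 (not_le.2 hlt)
  · have h1 := h.strictMono hlt
    rw [hhw] at h1
    rcases Set.mem_uIcc.1 hw with h2 | h2
    · exact absurd h2.1 (not_le.2 hlt)
    · exact absurd h2.1 (not_le.2 h1)

lemma apply_lt_of_lt {g h : HomeoI} (hfix : ∀ y, g y = y → h y = y) {x : unitInterval}
    (hx : g x < x) : g (h x) < h x := by
  have hx' : x < g⁻¹ x := by
    have := (g⁻¹).strictMono hx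
    rwa [inv_apply_self'] at this
  have := g.strictMono (lt_apply_of_lt (g := g⁻¹) (fun y hy => hfix y (inv_fix_iff.1 hy)) hx')
  rwa [apply_inv_self'] at this

lemma image_orbit (z : HomeoI) (x : unitInterval) :
    z '' (Set.range fun n : ℤ => (z ^ n) x) = Set.range fun n : ℤ => (z ^ n) x := by
  ext y
  constructor
  · rintro ⟨_, ⟨n, rfl⟩, rfl⟩
    exact ⟨1 + n, by simp only [zpow_one_add]; rfl⟩
  · rintro ⟨n, rfl⟩
    refine ⟨_, ⟨n - 1, rfl⟩, ?_⟩
    have : z ^ n = z * z ^ (n - 1) := by rw [← zpow_one_add]; congr 1; ring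
    simp only [this]; rfl

lemma exists_fix_isLUB_orbit (z : HomeoI) (x : unitInterval) :
    ∃ s, z s = s ∧ IsLUB (Set.range fun n : ℤ => (z ^ n) x) s := by
  refine ⟨sSup (Set.range fun n : ℤ => (z ^ n) x), ?_, isLUB_sSup _⟩
  have h1 := (OrderIso.isLUB_image' z).2 (isLUB_sSup (Set.range fun n : ℤ => (z ^ n) x))
  rw [image_orbit] at h1
  exact h1.unique (isLUB_sSup _)

lemma exists_fix_isGLB_orbit (z : HomeoI) (x : unitInterval) :
    ∃ s, z s = s ∧ IsGLB (Set.range fun n : ℤ => (z ^ n) x) s := by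
  refine ⟨sInf (Set.range fun n : ℤ => (z ^ n) x), ?_, isGLB_sInf _⟩
  have h1 := (OrderIso.isGLB_image' z).2 (isGLB_sInf (Set.range fun n : ℤ => (z ^ n) x))
  rw [image_orbit] at h1
  exact h1.unique (isGLB_sInf _)

lemma exists_lt_zpow_apply {z : HomeoI} {x y : unitInterval}
    (h : ∀ s, z s = s → x ≤ s → y < s) : ∃ n : ℤ, y < (z ^ n) x := by
  obtain ⟨s, hs, hlub⟩ := exists_fix_isLUB_orbit z x
  obtain ⟨_, ⟨n, rfl⟩, hn, -⟩ := hlub.exists_between (h s hs (hlub.1 ⟨0, rfl⟩))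
  exact ⟨n, hn⟩

lemma exists_zpow_apply_lt {z : HomeoI} {x y : unitInterval}
    (h : ∀ s, z s = s → s ≤ x → s < y) : ∃ n : ℤ, (z ^ n) x < y := by
  obtain ⟨s, hs, hglb⟩ := exists_fix_isGLB_orbit z x
  obtain ⟨_, ⟨n, rfl⟩, -, hn⟩ := hglb.exists_between (h s hs (hglb.1 ⟨0, rfl⟩))
  exact ⟨n, hn⟩

end Dynamics

section Analytic

lemma finite_fix {g : HomeoI} (hg : IsAnalytic g) (hne : g ≠ 1) : {x | g x = x}.Finite := by
  by_contra hinf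
  obtain ⟨F, hF, hFg⟩ := hg
  have hinf' : (Subtype.val '' {x : unitInterval | g x = x}).Infinite :=
    Set.Infinite.image Subtype.val_injective.injOn hinf
  obtain ⟨p, hp, hacc⟩ := hinf'.exists_accPt_of_subset_isCompact (K := Set.Icc (0 : ℝ) 1)
    isCompact_Icc (by rintro _ ⟨x, -, rfl⟩; exact x.2)
  have hfreq : ∃ᶠ y in 𝓝[≠] p, F y = id y := by
    rw [accPt_iff_frequently_nhdsNE] at hacc
    refine hacc.mono ?_
    rintro _ ⟨x, hx, rfl⟩
    rw [hFg, show g x = x from hx]; rfl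
  have := AnalyticOnNhd.eqOn_of_preconnected_of_frequently_eq (f := F) (g := id) hF
    (fun _ _ => analyticAt_id) isPreconnected_Icc hp hfreq
  apply hne
  ext x
  rw [← hFg, this x.2]; rfl

end Analytic

section Central

open scoped commutatorElement

lemma strictMono_zpow_apply {z : HomeoI} {t : unitInterval} (ht : t < z t) :
    StrictMono fun n : ℤ => (z ^ n) t := by
  refine strictMono_int_of_lt_succ fun n => ?_
  simp only [zpow_add_one]
  exact (z ^ n).strictMono ht

lemma not_lt_of_commutator_central {x y z : HomeoI} (hz : IsAnalytic z)
    (hω : ∀ i : ℤ, IsAnalytic ((z ^ i * x)⁻¹ * z))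
    (hxz : Commute x z) (hyz : Commute y z) (hxy : x * y = z * (y * x)) {t : unitInterval} :
    ¬ t < z t := by
  intro ht
  have hne : z ≠ 1 := by rintro rfl; exact lt_irrefl _ ht
  have hfz := finite_fix hz hne
  have hmono := strictMono_zpow_apply ht
  have hub : ∃ n : ℤ, x t < (z ^ n) t := exists_lt_zpow_apply fun s hs hts => by
    have hne : t ≠ s := by rintro rfl; exact ht.ne hs.symm
    have := x.strictMono (lt_of_le_of_ne hts hne)
    rwa [fix_of_commute hfz hxz hs] at this
  have hlb : ∃ n : ℤ, (z ^ n) t < x t := exists_zpow_apply_lt fun s hs hts => by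
    have hne : s ≠ t := by rintro rfl; exact ht.ne hs.symm
    have := x.strictMono (lt_of_le_of_ne hts hne)
    rwa [fix_of_commute hfz hxz hs] at this
  obtain ⟨N, hN⟩ := hub
  obtain ⟨M, hM⟩ := hlb
  obtain ⟨i, hi, himax⟩ := Int.exists_greatest_of_bdd (P := fun i : ℤ => (z ^ i) t ≤ x t)
    ⟨N, fun j hj => (hmono.lt_iff_lt.1 (hj.trans_lt hN)).le⟩ ⟨M, hM.le⟩
  have hi2 : x t < (z ^ (i + 1)) t := by
    by_contra! h
    have := himax _ h
    omega
  set w := z ^ (-i) * x with hw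
  have hwz : Commute w z := ((Commute.refl z).zpow_left (-i)).mul_left hxz
  have hwy : w * y = z * (y * w) := by
    have h1 : y * z ^ (-i) = z ^ (-i) * y := (hyz.zpow_right (-i)).eq
    have h2 : z * z ^ (-i) = z ^ (-i) * z := ((Commute.refl z).zpow_right (-i)).eq
    calc w * y = z ^ (-i) * (x * y) := by rw [hw, mul_assoc]
      _ = z ^ (-i) * z * (y * x) := by rw [hxy, mul_assoc]
      _ = z * (z ^ (-i) * y * x) := by rw [← h2]; simp only [mul_assoc]
      _ = z * (y * w) := by rw [← h1, hw]; simp only [mul_assoc]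
  have hw1 : t ≤ w t := by
    have := (z ^ (-i)).monotone hi
    rwa [← mul_apply', ← zpow_add, neg_add_cancel, zpow_zero] at this
  have hw2 : w t < z t := by
    have : (z ^ (-i) * x) t < (z ^ (-i) * z ^ (i + 1)) t := (z ^ (-i)).strictMono hi2
    rwa [← zpow_add, neg_add_cancel_left, zpow_one] at this
  have hgt : t < (w⁻¹ * z) t := by
    have := (w⁻¹).strictMono hw2
    rwa [inv_apply_self'] at this
  have hg : Commute z (w⁻¹ * z) := (hwz.symm.inv_right).mul_right (Commute.refl z)
  have hgne : w⁻¹ * z ≠ 1 := by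
    intro h
    rw [h] at hgt
    exact lt_irrefl _ hgt
  have hyt : y t < (w⁻¹ * z) (y t) := lt_apply_of_lt
    (fun s hs => fix_of_commute hfz hyz (fix_of_commute (finite_fix (hω (-i)) hgne) hg hs)) hgt
  have h1 : w (y t) < z (y t) := by
    have : w (y t) < w (w⁻¹ (z (y t))) := w.strictMono hyt
    rwa [apply_inv_self'] at this
  have h2 : z (y t) ≤ z (y (w t)) := z.monotone (y.monotone hw1)
  exact absurd (h1.trans_le h2) (by rw [← mul_apply', hwy]; exact lt_irrefl _)

/-- A group of analytic diffeomorphisms contains no Heisenberg group. -/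
lemma commutator_not_central {Γ : Subgroup HomeoI} (hω : ∀ f ∈ Γ, IsAnalytic f)
    {x y : HomeoI} (hx : x ∈ Γ) (hy : y ∈ Γ) (hne : ⁅x, y⁆ ≠ 1)
    (hxz : Commute x ⁅x, y⁆) (hyz : Commute y ⁅x, y⁆) : False := by
  set z := ⁅x, y⁆ with hzdef
  have hz : z ∈ Γ := Γ.mul_mem (Γ.mul_mem (Γ.mul_mem hx hy) (Γ.inv_mem hx)) (Γ.inv_mem hy)
  have hxy : x * y = z * (y * x) := by rw [hzdef, commutatorElement_def]; group
  apply hne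
  refine OrderIso.ext (funext fun t => ?_)
  change z t = t
  have h1 : ¬ t < z t := not_lt_of_commutator_central (hω z hz)
    (fun i => hω _ (Γ.mul_mem (Γ.inv_mem (Γ.mul_mem (Γ.zpow_mem hz i) hx)) hz)) hxz hyz hxy
  have hz' := Γ.inv_mem hz
  have hyx : y * x = z⁻¹ * (x * y) := by rw [hxy, inv_mul_cancel_left]
  have h2 : ¬ t < z⁻¹ t := not_lt_of_commutator_central (hω _ hz')
    (fun i => hω _ (Γ.mul_mem (Γ.inv_mem (Γ.mul_mem (Γ.zpow_mem hz' i) hy)) hz'))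
    hyz.inv_right hxz.inv_right hyx
  refine le_antisymm (not_lt.1 h1) (not_lt.1 fun h => h2 ?_)
  have := (z⁻¹).strictMono h
  rwa [inv_apply_self'] at this

lemma exists_noncentral {Γ : Subgroup HomeoI} (hω : ∀ f ∈ Γ, IsAnalytic f)
    (hsol : Group.IsSolvable ↥Γ) (hna : ¬ ∀ a ∈ Γ, ∀ b ∈ Γ, a * b = b * a) :
    ∃ A : Subgroup HomeoI, A ≤ Γ ∧ (∀ a ∈ A, ∀ b ∈ A, Commute a b) ∧
      (∀ f ∈ Γ, ∀ a ∈ A, f * a * f⁻¹ ∈ A) ∧ ∃ f ∈ Γ, ∃ a ∈ A, ¬ Commute f a := by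
  classical
  obtain ⟨n, hn, hmin⟩ : ∃ n, derivedSeries ↥Γ n = ⊥ ∧ ∀ m < n, derivedSeries ↥Γ m ≠ ⊥ :=
    ⟨Nat.find hsol.solvable, Nat.find_spec hsol.solvable, fun m hm => Nat.find_min hsol.solvable hm⟩
  have hcomm : ∀ m, derivedSeries ↥Γ (m + 1) = ⊥ →
      ∀ a ∈ derivedSeries ↥Γ m, ∀ b ∈ derivedSeries ↥Γ m, Commute a b := by
    intro m hm a ha b hb
    have : ⁅a, b⁆ ∈ derivedSeries ↥Γ (m + 1) := Subgroup.commutator_mem_commutator ha hb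
    rw [hm, Subgroup.mem_bot] at this
    exact commutatorElement_eq_one_iff_commute.1 this
  have hna0 : derivedSeries ↥Γ 1 ≠ ⊥ := by
    intro h
    apply hna
    intro a ha b hb
    exact congrArg Subtype.val (hcomm 0 h ⟨a, ha⟩ (by simp) ⟨b, hb⟩ (by simp)).eq
  obtain ⟨l, rfl⟩ : ∃ l, n = l + 2 := by
    match n with
    | 0 => exact absurd (le_bot_iff.1 (hn ▸ derivedSeries_antitone ↥Γ (Nat.zero_le 1))) hna0
    | 1 => exact absurd hn hna0
    | l + 2 => exact ⟨l, rfl⟩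
  have hl := hmin (l + 1) (by omega)
  obtain ⟨x, hx, y, hy, hxy⟩ : ∃ x ∈ derivedSeries ↥Γ l, ∃ y ∈ derivedSeries ↥Γ l, ⁅x, y⁆ ≠ 1 := by
    by_contra! h
    exact hl (le_bot_iff.1 (Subgroup.commutator_le.2 fun a ha b hb =>
      Subgroup.mem_bot.2 (h a ha b hb)))
  refine ⟨(derivedSeries ↥Γ (l + 1)).map Γ.subtype, ?_, ?_, ?_, ?_⟩
  · rintro _ ⟨a, -, rfl⟩
    exact a.2
  · rintro _ ⟨a, ha, rfl⟩ _ ⟨b, hb, rfl⟩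
    exact (hcomm _ hn a ha b hb).map Γ.subtype
  · rintro f hf _ ⟨a, ha, rfl⟩
    exact ⟨⟨f, hf⟩ * a * ⟨f, hf⟩⁻¹, (derivedSeries_normal ↥Γ (l + 1)).conj_mem a ha ⟨f, hf⟩, rfl⟩
  · by_contra! h
    have hmem : ⁅x, y⁆ ∈ derivedSeries ↥Γ (l + 1) := Subgroup.commutator_mem_commutator hx hy
    exact commutator_not_central hω x.2 y.2 (fun h1 => hxy (Subtype.ext h1))
      (h x x.2 _ ⟨_, hmem, rfl⟩) (h y y.2 _ ⟨_, hmem, rfl⟩)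

end Central

section Local

/-- `g` has derivative `μ` at `q` (through an extension to the real line). -/
def HasMult (g : HomeoI) (q : unitInterval) (μ : ℝ) : Prop :=
  ∃ F : ℝ → ℝ, HasStrictDerivAt F μ q ∧ ∀ x : unitInterval, F x = (g x : ℝ)

lemma IsAnalytic.exists_hasMult {g : HomeoI} (hg : IsAnalytic g) (q : unitInterval) :
    ∃ μ, HasMult g q μ := by
  obtain ⟨F, hF, hFg⟩ := hg
  exact ⟨_, F, (hF q q.2).hasStrictDerivAt, hFg⟩

lemma HasMult.isLittleO {g : HomeoI} {q : unitInterval} {μ : ℝ} (h : HasMult g q μ) :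
    (fun p : unitInterval × unitInterval => (g p.1 : ℝ) - g p.2 - μ * (p.1 - p.2)) =o[𝓝 (q, q)]
      fun p => (p.1 : ℝ) - p.2 := by
  obtain ⟨F, hF, hFg⟩ := h
  have h1 := (hasStrictDerivAt_iff_hasStrictFDerivAt.1 hF).isLittleO
  have ht : Tendsto (fun p : unitInterval × unitInterval => ((p.1 : ℝ), (p.2 : ℝ))) (𝓝 (q, q))
      (𝓝 ((q : ℝ), (q : ℝ))) :=
    (by fun_prop : Continuous fun p : unitInterval × unitInterval =>
      ((p.1 : ℝ), (p.2 : ℝ))).tendsto (q, q)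
  refine (h1.comp_tendsto ht).congr (fun p => ?_) (fun p => rfl)
  simp [hFg, mul_comm]

lemma HasMult.isBigO {g : HomeoI} {q : unitInterval} {μ : ℝ} (h : HasMult g q μ) :
    (fun p : unitInterval × unitInterval => (g p.1 : ℝ) - g p.2) =O[𝓝 (q, q)]
      fun p => (p.1 : ℝ) - p.2 := by
  refine (h.isLittleO.isBigO.add ((isBigO_refl _ _).const_mul_left μ)).congr_left fun p => ?_
  ring

lemma HasMult.dist_le {g : HomeoI} {q : unitInterval} {μ L : ℝ} (h : HasMult g q μ) (hμ : 0 ≤ μ)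
    (hL : μ < L) : ∀ᶠ p : unitInterval × unitInterval in 𝓝 (q, q),
      dist (g p.1) (g p.2) ≤ L * dist p.1 p.2 := by
  filter_upwards [h.isLittleO.bound (sub_pos.2 hL)] with p hp
  rw [Subtype.dist_eq, Subtype.dist_eq, Real.dist_eq, Real.dist_eq]
  rw [Real.norm_eq_abs, Real.norm_eq_abs] at hp
  have h1 : |(g p.1 : ℝ) - g p.2| ≤ |(g p.1 : ℝ) - g p.2 - μ * (p.1 - p.2)| + |μ * (p.1 - p.2)| := by
    have := abs_add_le ((g p.1 : ℝ) - g p.2 - μ * (p.1 - p.2)) (μ * (p.1 - p.2))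
    simpa using this
  rw [abs_mul, abs_of_nonneg hμ] at h1
  linarith

lemma HasMult.hasDerivWithinAt {g : HomeoI} {q : unitInterval} {μ : ℝ} (h : HasMult g q μ) :
    HasDerivWithinAt (fun x : ℝ => (g (Set.projIcc 0 1 zero_le_one x) : ℝ)) μ (Set.Icc 0 1) q := by
  obtain ⟨F, hF, hFg⟩ := h
  have key : ∀ x ∈ Set.Icc (0 : ℝ) 1, (g (Set.projIcc 0 1 zero_le_one x) : ℝ) = F x := fun x hx => by
    rw [Set.projIcc_of_mem _ hx, ← hFg]
  exact hF.hasDerivAt.hasDerivWithinAt.congr key (key q q.2)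

lemma HasMult.inv {g : HomeoI} {q : unitInterval} {μ : ℝ} (h : HasMult g q μ) (hq : g q = q)
    (hg : IsAnalytic g⁻¹) : 0 < μ ∧ HasMult g⁻¹ q μ⁻¹ := by
  obtain ⟨ν, hν⟩ := hg.exists_hasMult q
  have hud := uniqueDiffOn_Icc (zero_lt_one' ℝ) q q.2
  have h1 := h.hasDerivWithinAt
  have h2 := hν.hasDerivWithinAt
  have hgq : (g (Set.projIcc 0 1 zero_le_one (q : ℝ)) : ℝ) = q := by
    rw [Set.projIcc_val, hq]
  have h3 := HasDerivWithinAt.comp (q : ℝ) (by rw [hgq]; exact h2) h1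
    (fun x _ => (g (Set.projIcc 0 1 zero_le_one x)).2)
  have h4 : HasDerivWithinAt id (ν * μ) (Set.Icc 0 1) (q : ℝ) := by
    refine h3.congr (fun x hx => ?_) ?_
    · simp only [Function.comp, Set.projIcc_val, inv_apply_self', Set.projIcc_of_mem _ hx, id]
    · simp only [Function.comp, Set.projIcc_val, inv_apply_self', id]
  have h5 : ν * μ = 1 := hud.eq_deriv _ h4 (hasDerivWithinAt_id _ _)
  have hmono : MonotoneOn (fun x : ℝ => (g (Set.projIcc 0 1 zero_le_one x) : ℝ)) (Set.Icc 0 1) :=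
    fun x _ y _ hxy => g.monotone (Set.monotone_projIcc _ hxy)
  have h6 : 0 ≤ μ := by
    rw [← h1.derivWithin hud]
    exact hmono.derivWithin_nonneg
  have h7 : μ ≠ 0 := by rintro rfl; simp at h5
  exact ⟨lt_of_le_of_ne h6 h7.symm, by rwa [← eq_inv_of_mul_eq_one_left h5]⟩

lemma tendsto_of_fix {g : HomeoI} {q : unitInterval} (hq : g q = q) : Tendsto g (𝓝 q) (𝓝 q) := by
  simpa [hq] using g.continuous.tendsto q

lemma IsAnalytic.isBigO_sub {g : HomeoI} {q : unitInterval} (hg : IsAnalytic g) (hq : g q = q) :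
    (fun x : unitInterval => (g x : ℝ) - q) =O[𝓝 q] fun x => (x : ℝ) - q := by
  obtain ⟨μ, hμ⟩ := hg.exists_hasMult q
  have := hμ.isBigO.comp_tendsto (k := fun x => (x, q)) (by
    exact (by fun_prop : Continuous fun x : unitInterval => (x, q)).tendsto q)
  simpa [Function.comp_def, hq] using this

lemma exists_order {a : HomeoI} (ha : IsAnalytic a) (hne : a ≠ 1) {q : unitInterval}
    (hq : a q = q) : ∃ k : ℕ, 1 ≤ k ∧ ∃ c : ℝ, c ≠ 0 ∧
      (fun x : unitInterval => (a x : ℝ) - x - c * ((x : ℝ) - q) ^ k) =o[𝓝 q]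
        fun x => ((x : ℝ) - q) ^ k := by
  have hfin := finite_fix ha hne
  obtain ⟨F, hF, hFa⟩ := ha
  have hval : Tendsto (fun x : unitInterval => (x : ℝ)) (𝓝 q) (𝓝 (q : ℝ)) :=
    continuous_subtype_val.tendsto q
  have hG : AnalyticAt ℝ (fun x => F x - x) q := (hF q q.2).sub analyticAt_id
  have hnz : ¬ ∀ᶠ z in 𝓝 (q : ℝ), F z - z = 0 := by
    intro h
    have h1 : ∀ᶠ x : unitInterval in 𝓝 q, x ∈ {x | a x = x} := by
      filter_upwards [hval.eventually h] with x hx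
      rw [hFa, sub_eq_zero] at hx
      exact Subtype.ext hx
    exact (infinite_of_mem_nhds q h1) hfin
  obtain ⟨k, G, hGan, hGq, hGeq⟩ := hG.exists_eventuallyEq_pow_smul_nonzero_iff.2 hnz
  refine ⟨k, ?_, G q, hGq, ?_⟩
  · rw [Nat.one_le_iff_ne_zero]
    rintro rfl
    have := hGeq.self_of_nhds
    rw [hFa, hq] at this
    simp at this
    exact hGq this.symm
  · have h1 : (fun x : unitInterval => G x - G q) =o[𝓝 q] fun _ => (1 : ℝ) := by
      rw [isLittleO_one_iff]
      have := (hGan.continuousAt.tendsto.comp hval).sub_const (G q)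
      simpa using this
    have h2 := (isBigO_refl (fun x : unitInterval => ((x : ℝ) - q) ^ k) (𝓝 q)).mul_isLittleO h1
    refine h2.congr' ?_ (by simp)
    filter_upwards [hval.eventually hGeq] with x hx
    rw [← hFa, hx, smul_eq_mul]
    ring

lemma isBigO_of_order {a : HomeoI} {q : unitInterval} {k : ℕ} {c : ℝ}
    (h : (fun x : unitInterval => (a x : ℝ) - x - c * ((x : ℝ) - q) ^ k) =o[𝓝 q]
        fun x => ((x : ℝ) - q) ^ k) :
    (fun x : unitInterval => (a x : ℝ) - x) =O[𝓝 q] fun x => ((x : ℝ) - q) ^ k :=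
  (h.isBigO.add ((isBigO_refl _ _).const_mul_left c)).congr_left fun x => by ring

/-- If the multiplier `μ` of `f` satisfies `μ ^ k = μ`, then `f` commutes with `a` up to terms of
order higher than the order of contact `k` of `a` with the identity. -/
lemma isLittleO_comm {f a : HomeoI} (hf : IsAnalytic f) {q : unitInterval}
    (hfq : f q = q) (haq : a q = q) {μ : ℝ} (hμ : HasMult f q μ) (hμ0 : μ ≠ 0)
    {k : ℕ} {c : ℝ}
    (h : (fun x : unitInterval => (a x : ℝ) - x - c * ((x : ℝ) - q) ^ k) =o[𝓝 q]
        fun x => ((x : ℝ) - q) ^ k) (hpow : μ ^ k = μ) :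
    (fun x : unitInterval => (a (f x) : ℝ) - f (a x)) =o[𝓝 q] fun x => ((x : ℝ) - q) ^ k := by
  have hfO := hf.isBigO_sub hfq
  have e2 := (h.comp_tendsto (tendsto_of_fix hfq)).trans_isBigO (hfO.pow k)
  have e0 : (fun x : unitInterval => (f x : ℝ) - q - μ * ((x : ℝ) - q)) =o[𝓝 q]
      fun x => (x : ℝ) - q := by
    have := hμ.isLittleO.comp_tendsto (k := fun x => (x, q)) (l' := 𝓝 q)
      ((by fun_prop : Continuous fun x : unitInterval => (x, q)).tendsto q)
    simpa [Function.comp_def, hfq] using this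
  have e3 : (fun x : unitInterval => ((f x : ℝ) - q) ^ k - μ ^ k * ((x : ℝ) - q) ^ k) =o[𝓝 q]
      fun x => ((x : ℝ) - q) ^ k := by
    have he : IsEquivalent (𝓝 q) (fun x : unitInterval => (f x : ℝ) - q)
        (fun x => μ * ((x : ℝ) - q)) :=
      e0.trans_isBigO ((isBigO_refl _ _).const_mul_right hμ0 (c := μ))
    have hp := he.pow k
    have ho : ((fun x : unitInterval => μ * ((x : ℝ) - q)) ^ k) =O[𝓝 q]
        fun x => ((x : ℝ) - q) ^ k :=
      ((isBigO_refl _ _).const_mul_left (μ ^ k)).congr_left fun x => by simp [mul_pow]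
    exact (hp.isLittleO.trans_isBigO ho).congr_left fun x => by simp [mul_pow]
  have e4 : (fun x : unitInterval => (f (a x) : ℝ) - f x - μ * (a x - x)) =o[𝓝 q]
      fun x => ((x : ℝ) - q) ^ k := by
    have ht : Tendsto (fun x => (a x, x)) (𝓝 q) (𝓝 (q, q)) := by
      have := (tendsto_of_fix haq).prodMk_nhds (tendsto_id (α := unitInterval) (x := 𝓝 q))
      exact this
    exact (hμ.isLittleO.comp_tendsto ht).trans_isBigO (isBigO_of_order h)
  refine (((e2.add (e3.const_mul_left c)).sub e4).sub (h.const_mul_left μ)).congr_left fun x => ?_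
  simp only [Function.comp, hpow]
  ring

lemma isLittleO_pow_apply {b : HomeoI} (hb : IsAnalytic b) {q : unitInterval} (hq : b q = q) {k : ℕ}
    (h : (fun x : unitInterval => (b x : ℝ) - x) =o[𝓝 q] fun x => ((x : ℝ) - q) ^ k) (n : ℕ) :
    (fun x : unitInterval => ((b ^ n) x : ℝ) - x) =o[𝓝 q] fun x => ((x : ℝ) - q) ^ k := by
  induction n with
  | zero => simp [one_apply']
  | succ n ih =>
    have h1 := (ih.comp_tendsto (tendsto_of_fix hq)).trans_isBigO ((hb.isBigO_sub hq).pow k)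
    refine (h1.add h).congr_left fun x => ?_
    rw [pow_succ, mul_apply']
    simp

lemma isLittleO_inv_apply {b : HomeoI} (hb : IsAnalytic b⁻¹) {q : unitInterval} (hq : b q = q)
    {k : ℕ}
    (h : (fun x : unitInterval => (b x : ℝ) - x) =o[𝓝 q] fun x => ((x : ℝ) - q) ^ k) :
    (fun x : unitInterval => (b⁻¹ x : ℝ) - x) =o[𝓝 q] fun x => ((x : ℝ) - q) ^ k := by
  have h1 := (h.comp_tendsto (tendsto_of_fix (inv_fix hq))).trans_isBigO
    ((hb.isBigO_sub (inv_fix hq)).pow k)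
  refine h1.neg_left.congr_left fun x => ?_
  simp [apply_inv_self']

lemma isLittleO_zpow_apply {b : HomeoI} (hb : IsAnalytic b) (hb' : IsAnalytic b⁻¹)
    {q : unitInterval} (hq : b q = q) {k : ℕ}
    (h : (fun x : unitInterval => (b x : ℝ) - x) =o[𝓝 q] fun x => ((x : ℝ) - q) ^ k) (n : ℤ) :
    (fun x : unitInterval => ((b ^ n) x : ℝ) - x) =o[𝓝 q] fun x => ((x : ℝ) - q) ^ k := by
  cases n with
  | ofNat n => simpa using isLittleO_pow_apply hb hq h n
  | negSucc n =>
    rw [zpow_negSucc, ← inv_pow]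
    exact isLittleO_pow_apply hb' (inv_fix hq) (isLittleO_inv_apply hb' hq h) (n + 1)

lemma exists_lt_of_finite {S : Set unitInterval} (hS : S.Finite) (h0 : 0 ∈ S) {q : unitInterval}
    (hq : q ≠ 0) : ∃ x < q, x ∉ S ∧ ∀ s ∈ S, s < q → s < x := by
  have hT : {s ∈ S | s < q}.Finite := hS.subset (Set.sep_subset _ _)
  obtain ⟨m, ⟨hm, hmq⟩, hmax⟩ := Set.exists_max_image _ id hT ⟨0, h0, unitInterval.pos_iff_ne_zero.2 hq⟩
  obtain ⟨x, hmx, hxq⟩ := exists_between hmq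
  exact ⟨x, hxq, fun hx => absurd (hmax x ⟨hx, hxq⟩) (not_le.2 hmx),
    fun s hs hsq => (hmax s ⟨hs, hsq⟩).trans_lt hmx⟩

lemma apply_zero (g : HomeoI) : g 0 = 0 := g.map_bot

/-- The orbit of a point just below a nonzero fixed point `q` of `a` accumulates to `q`. -/
lemma isLUB_orbit {a : HomeoI} {q x : unitInterval} (hq : a q = q) (hx : x < q)
    (h : ∀ s, a s = s → s < q → s < x) : IsLUB (Set.range fun n : ℤ => (a ^ n) x) q := by
  obtain ⟨s, hs, hlub⟩ := exists_fix_isLUB_orbit a x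
  have hsq : s ≤ q := hlub.2 (by
    rintro _ ⟨n, rfl⟩
    have := (a ^ n).monotone hx.le
    rwa [zpow_fix hq] at this)
  have hxs : x ≤ s := hlub.1 ⟨0, rfl⟩
  rcases hsq.lt_or_eq with hlt | rfl
  · exact absurd (h s hs hlt) (not_lt.2 hxs)
  · exact hlub

/-- Two commuting nontrivial analytic diffeomorphisms have the same order of contact with the
identity at a common fixed point. -/
lemma eq_one_of_isLittleO {a b : HomeoI} (ha : IsAnalytic a) (hane : a ≠ 1) (hb : IsAnalytic b)
    (hb' : IsAnalytic b⁻¹) (hab : Commute a b) {q : unitInterval} (hq0 : q ≠ 0) (haq : a q = q)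
    {k : ℕ} {c : ℝ} (hc : c ≠ 0)
    (h : (fun x : unitInterval => (a x : ℝ) - x - c * ((x : ℝ) - q) ^ k) =o[𝓝 q]
        fun x => ((x : ℝ) - q) ^ k)
    (hlit : (fun x : unitInterval => (b x : ℝ) - x) =o[𝓝 q] fun x => ((x : ℝ) - q) ^ k) :
    b = 1 := by
  by_contra hbne
  have hfa := finite_fix ha hane
  have hfb := finite_fix hb hbne
  have hbq : b q = q := fix_of_commute hfa hab.symm haq
  obtain ⟨x, hxq, hxa, hx⟩ := exists_lt_of_finite hfa (apply_zero a) hq0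
  have hlub := isLUB_orbit haq hxq hx
  obtain ⟨N, hN⟩ : ∃ N : ℤ, ∀ n : ℤ,
      |((a ((a ^ n) x) : unitInterval) : ℝ) - (a ^ n) x| ≤
        |((b ^ N) ((a ^ n) x) : ℝ) - (a ^ n) x| := by
    have hanz : ∀ n : ℤ, a ((a ^ n) x) = (a ^ n) (a x) := fun n =>
      commute_apply ((Commute.refl a).zpow_right n) x
    have hbnz : ∀ N n : ℤ, (b ^ N) ((a ^ n) x) = (a ^ n) ((b ^ N) x) := fun N n =>
      commute_apply (hab.symm.zpow_zpow N n) x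
    rcases lt_trichotomy (a x) x with hlt | heq | hgt
    · obtain ⟨N, hN⟩ := exists_zpow_apply_lt (z := b) (x := x) (y := a x) fun s hs hsx => by
        have has := fix_of_commute hfb hab hs
        have := a.strictMono (lt_of_le_of_ne hsx (by rintro rfl; exact hxa has))
        rwa [has] at this
      refine ⟨N, fun n => ?_⟩
      have h1 : (((a ^ n) ((b ^ N) x) : unitInterval) : ℝ) ≤ (a ^ n) (a x) := (a ^ n).monotone hN.le
      have h2 : (((a ^ n) (a x) : unitInterval) : ℝ) ≤ (a ^ n) x := (a ^ n).monotone hlt.le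
      rw [hanz, hbnz, abs_of_nonpos (by linarith), abs_of_nonpos (by linarith)]
      linarith
    · exact absurd heq hxa
    · obtain ⟨N, hN⟩ := exists_lt_zpow_apply (z := b) (x := x) (y := a x) fun s hs hsx => by
        have has := fix_of_commute hfb hab hs
        have := a.strictMono (lt_of_le_of_ne hsx (by rintro rfl; exact hxa has))
        rwa [has] at this
      refine ⟨N, fun n => ?_⟩
      have h1 : (((a ^ n) (a x) : unitInterval) : ℝ) ≤ (a ^ n) ((b ^ N) x) := (a ^ n).monotone hN.le
      have h2 : (((a ^ n) x : unitInterval) : ℝ) ≤ (a ^ n) (a x) := (a ^ n).monotone hgt.le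
      rw [hanz, hbnz, abs_of_nonneg (by linarith), abs_of_nonneg (by linarith)]
      linarith
  have hc' : 0 < |c| / 4 := by positivity
  have hfreq := mem_closure_iff_frequently.1 (hlub.mem_closure (Set.range_nonempty _))
  obtain ⟨_, ⟨n, rfl⟩, h1, h2⟩ := (hfreq.and_eventually
    ((h.bound hc').and ((isLittleO_zpow_apply hb hb' hbq hlit N).bound hc'))).exists
  set y := (a ^ n) x with hy
  have hyq : (y : ℝ) - q ≠ 0 := by
    have : y < q := by
      have := (a ^ n).strictMono hxq
      rwa [zpow_fix haq] at this
    exact (sub_neg.2 (show (y : ℝ) < q from this)).ne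
  have hpos : 0 < |((y : ℝ) - q) ^ k| := abs_pos.2 (pow_ne_zero _ hyq)
  have h3 := hN n
  simp only [Real.norm_eq_abs] at h1 h2
  have h4 : |c| * |((y : ℝ) - q) ^ k| ≤
      |(a y : ℝ) - y - c * ((y : ℝ) - q) ^ k| + |(a y : ℝ) - y| := by
    rw [← abs_mul]
    have := abs_sub ((a y : ℝ) - y) ((a y : ℝ) - y - c * ((y : ℝ) - q) ^ k)
    rw [sub_sub_cancel] at this
    linarith
  have hcp : 0 < |c| * |((y : ℝ) - q) ^ k| := mul_pos (abs_pos.2 hc) hpos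
  change |(a y : ℝ) - y| ≤ _ at h3
  linarith

/-- If `a` and `f a f⁻¹` commute but `a` and `f` do not, then the multiplier `μ` of `f` at a fixed
point of order `k` of `a` satisfies `μ ^ k ≠ μ`. -/
lemma mult_pow_ne {Γ : Subgroup HomeoI} (hω : ∀ f ∈ Γ, IsAnalytic f) {f a : HomeoI} (hf : f ∈ Γ)
    (ha : a ∈ Γ) (hcomm : Commute a (f⁻¹ * a * f)) (hne : ¬ Commute f a) {q : unitInterval}
    (hq0 : q ≠ 0) (haq : a q = q) (hfq : f q = q) {μ : ℝ} (hμ : HasMult f q μ)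
    {k : ℕ} {c : ℝ} (hc : c ≠ 0)
    (h : (fun x : unitInterval => (a x : ℝ) - x - c * ((x : ℝ) - q) ^ k) =o[𝓝 q]
        fun x => ((x : ℝ) - q) ^ k) : μ ^ k ≠ μ := by
  intro hpow
  have hf' := Γ.inv_mem hf
  have ha' := Γ.inv_mem ha
  have hane : a ≠ 1 := by rintro rfl; exact hne (Commute.one_right f)
  set b := f⁻¹ * a * f * a⁻¹ with hb
  have hbΓ : b ∈ Γ := Γ.mul_mem (Γ.mul_mem (Γ.mul_mem hf' ha) hf) ha'
  have h1 := isLittleO_comm (hω f hf) hfq haq hμ (hμ.inv hfq (hω _ hf')).1.ne' h hpow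
  obtain ⟨ν, hν⟩ := (hω _ hf').exists_hasMult q
  have ht : Tendsto (fun x => (a (f x), f (a x))) (𝓝 q) (𝓝 (q, q)) :=
    ((tendsto_of_fix haq).comp (tendsto_of_fix hfq)).prodMk_nhds
      ((tendsto_of_fix hfq).comp (tendsto_of_fix haq))
  have h2 := (hν.isBigO.comp_tendsto ht).trans_isLittleO h1
  have h3 := (h2.comp_tendsto (tendsto_of_fix (inv_fix haq))).trans_isBigO
    (((hω _ ha').isBigO_sub (inv_fix haq)).pow k)
  have hlit : (fun x : unitInterval => (b x : ℝ) - x) =o[𝓝 q] fun x => ((x : ℝ) - q) ^ k := by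
    refine h3.congr_left fun x => ?_
    simp only [Function.comp, apply_inv_self', inv_apply_self', hb, mul_apply']
  have hb1 := eq_one_of_isLittleO (hω a ha) hane (hω b hbΓ) (hω _ (Γ.inv_mem hbΓ))
    (hcomm.mul_right (Commute.refl a).inv_right) hq0 haq hc h hlit
  apply hne
  have h5 : f⁻¹ * a * f = a := mul_inv_eq_one.1 hb1
  have : f * a = a * f := by
    conv_lhs => rw [← h5]
    group
  exact this

end Local

section Convergence

/-- Conjugating a diffeomorphism tangent to the identity at `q` by iterates of a contraction at `q`
gives a sequence converging to the identity near `q`. -/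
lemma eventually_tendsto_conj {f a : HomeoI} (hf' : IsAnalytic f⁻¹) {q : unitInterval}
    (hfq : f q = q) {μ : ℝ} (hμ : HasMult f q μ) (hμ1 : μ < 1)
    (ha : (fun x : unitInterval => (a x : ℝ) - x) =O[𝓝 q] fun x => ((x : ℝ) - q) ^ 2) :
    ∀ᶠ x in 𝓝 q, Tendsto (fun n : ℕ => (f⁻¹ ^ n * a * f ^ n) x) atTop (𝓝 x) := by
  obtain ⟨hμ0, hν⟩ := hμ.inv hfq hf'
  obtain ⟨M, hμM, hM⟩ : ∃ M, μ < M ∧ M ^ 2 < μ := by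
    obtain ⟨M, h1, h2⟩ := exists_between (Real.lt_sqrt_of_sq_lt (show μ ^ 2 < μ by nlinarith))
    exact ⟨M, h1, (Real.lt_sqrt (hμ0.trans h1).le).1 h2⟩
  have hM0 : 0 < M := hμ0.trans hμM
  have hM1 : M < 1 := by nlinarith
  have hM2 : 0 < M ^ 2 := by positivity
  obtain ⟨L, hμL, hL⟩ := exists_between (inv_strictAnti₀ hM2 hM)
  have hL1 : 1 < L := (one_lt_inv₀ hμ0 |>.2 hμ1).trans hμL
  have hLM : L * M ^ 2 < 1 := by
    have := mul_lt_mul_of_pos_right hL hM2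
    rwa [inv_mul_cancel₀ hM2.ne'] at this
  have hLM0 : 0 ≤ L * M ^ 2 := by positivity
  obtain ⟨C, hC0, hC⟩ := ha.exists_pos
  have hfd := hμ.dist_le hμ0.le hμM
  have hgd := hν.dist_le (inv_nonneg.2 hμ0.le) hμL
  obtain ⟨δ₁, hδ₁, h₁⟩ := Metric.eventually_nhds_iff.1 hfd
  obtain ⟨δ₂, hδ₂, h₂⟩ := Metric.eventually_nhds_iff.1 hgd
  obtain ⟨δ₃, hδ₃, h₃⟩ := Metric.eventually_nhds_iff.1 hC.bound
  obtain ⟨δ, hδ, hδ₁', hδ₂', hδ₃'⟩ : ∃ δ > 0, δ ≤ δ₁ ∧ δ ≤ δ₂ ∧ δ ≤ δ₃ :=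
    ⟨min δ₁ (min δ₂ δ₃), by positivity, min_le_left _ _,
      (min_le_right _ _).trans (min_le_left _ _), (min_le_right _ _).trans (min_le_right _ _)⟩
  have hf : ∀ u, dist u q < δ → dist (f u) q ≤ M * dist u q := fun u hu => by
    have := h₁ (y := (u, q)) (by rw [Prod.dist_eq]; simpa [hδ₁] using hu.trans_le hδ₁')
    simpa only [hfq] using this
  have hg : ∀ u v, dist u q < δ → dist v q < δ → dist (f⁻¹ u) (f⁻¹ v) ≤ L * dist u v :=
    fun u v hu hv => h₂ (y := (u, v)) (by
      rw [Prod.dist_eq]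
      exact max_lt (hu.trans_le hδ₂') (hv.trans_le hδ₂'))
  have haq : ∀ u, dist u q < δ → dist (a u) u ≤ C * dist u q ^ 2 := fun u hu => by
    have := h₃ (hu.trans_le hδ₃')
    rwa [norm_pow, Real.norm_eq_abs, Real.norm_eq_abs, ← Real.dist_eq, ← Real.dist_eq,
      ← Subtype.dist_eq, ← Subtype.dist_eq] at this
  filter_upwards [Metric.ball_mem_nhds q (half_pos hδ)] with x hx
  rw [Metric.mem_ball] at hx
  have horb : ∀ n, dist ((f ^ n) x) q ≤ M ^ n * dist x q := by
    intro n
    induction n with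
    | zero => simp [one_apply']
    | succ n ih =>
      have hle : M ^ n * dist x q ≤ dist x q :=
        mul_le_of_le_one_left dist_nonneg (pow_le_one₀ hM0.le hM1.le)
      rw [pow_succ', mul_apply', pow_succ', mul_assoc]
      exact (hf _ (by linarith)).trans (mul_le_mul_of_nonneg_left ih hM0.le)
  have horb' : ∀ n, dist ((f ^ n) x) q < δ / 2 := fun n =>
    (horb n).trans_lt ((mul_le_of_le_one_left dist_nonneg
      (pow_le_one₀ hM0.le hM1.le)).trans_lt hx)
  set e : ℕ → ℝ := fun n => C * (M ^ n * dist x q) ^ 2 with he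
  have hae : ∀ n, dist (a ((f ^ n) x)) ((f ^ n) x) ≤ e n := fun n =>
    (haq _ (by linarith [horb' n])).trans (by
      have := horb n
      simp only [he]
      gcongr)
  have hLe : ∀ n, L ^ n * e n = (L * M ^ 2) ^ n * (C * dist x q ^ 2) := fun n => by
    simp only [he, mul_pow, ← pow_mul]
    rw [mul_comm n 2]
    ring
  have hlim : Tendsto (fun n => L ^ n * e n) atTop (𝓝 0) := by
    simp only [hLe]
    simpa using (tendsto_pow_atTop_nhds_zero_of_lt_one hLM0 hLM).mul_const (C * dist x q ^ 2)
  rw [tendsto_iff_dist_tendsto_zero]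
  refine squeeze_zero' (Eventually.of_forall fun n => dist_nonneg) ?_ hlim
  filter_upwards [hlim.eventually (gt_mem_nhds (half_pos hδ))] with n hn
  have hen : 0 ≤ e n := by simp only [he]; positivity
  have hstep : ∀ i ≤ n, dist ((f⁻¹ ^ i) (a ((f ^ n) x))) ((f ^ (n - i)) x) ≤ L ^ i * e n := by
    intro i
    induction i with
    | zero => intro _; simpa [one_apply'] using hae n
    | succ i ih =>
      intro hi
      have h1 := ih (by omega)
      have h2 : L ^ i * e n ≤ L ^ n * e n :=
        mul_le_mul_of_nonneg_right (pow_le_pow_right₀ hL1.le (by omega)) hen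
      have h3 := horb' (n - i)
      have h4 := dist_triangle ((f⁻¹ ^ i) (a ((f ^ n) x))) ((f ^ (n - i)) x) q
      have h5 : (f ^ (n - (i + 1))) x = f⁻¹ ((f ^ (n - i)) x) := by
        rw [show n - i = (n - (i + 1)) + 1 by omega, pow_succ', mul_apply', inv_apply_self']
      rw [h5, pow_succ' f⁻¹, mul_apply', pow_succ' L, mul_assoc]
      exact (hg _ _ (by linarith) (by linarith)).trans
        (mul_le_mul_of_nonneg_left h1 (by linarith))
  have := hstep n le_rfl
  rw [Nat.sub_self, pow_zero] at this
  exact this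

end Convergence

section Uniform

lemma eventually_forall_abs_lt {b : ℕ → HomeoI}
    (hb : ∀ x, Tendsto (fun n => b n x) atTop (𝓝 x)) {ε : ℝ} (hε : 0 < ε) :
    ∀ᶠ n in atTop, ∀ x : unitInterval, |(b n x : ℝ) - x| < ε := by
  obtain ⟨N, hN⟩ := exists_nat_one_div_lt (half_pos hε)
  have hN0 : (0 : ℝ) < N + 1 := by positivity
  have hmem : ∀ i : Fin (N + 2), (i : ℝ) / (N + 1) ∈ Set.Icc (0 : ℝ) 1 := fun i =>
    ⟨by positivity, by
      rw [div_le_one hN0]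
      exact_mod_cast Nat.lt_succ_iff.1 i.2⟩
  have hev : ∀ᶠ n in atTop, ∀ i : Fin (N + 2),
      |(b n ⟨_, hmem i⟩ : ℝ) - (i : ℝ) / (N + 1)| < ε / 2 := by
    rw [eventually_all]
    intro i
    filter_upwards [(hb ⟨_, hmem i⟩).eventually (Metric.ball_mem_nhds _ (half_pos hε))] with n hn
    rwa [Subtype.dist_eq, Real.dist_eq] at hn
  filter_upwards [hev] with n hn x
  have h0 := x.2.1
  have h1 := x.2.2
  rcases h1.eq_or_lt with h1 | h1
  · have : x = 1 := Subtype.ext h1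
    rw [this, show b n 1 = 1 from (b n).map_top]
    simpa using hε
  have hfl := Nat.floor_le (a := (x : ℝ) * (N + 1)) (by positivity)
  have hfl' := Nat.lt_floor_add_one ((x : ℝ) * (N + 1))
  set i := ⌊(x : ℝ) * (N + 1)⌋₊ with hi
  have hiN : i < N + 1 := by
    have : (i : ℝ) < N + 1 := hfl.trans_lt (by nlinarith)
    exact_mod_cast this
  have hl := hn ⟨i, by omega⟩
  have hr := hn ⟨i + 1, by omega⟩
  have hxl : (i : ℝ) / (N + 1) ≤ x := (div_le_iff₀ hN0).2 hfl
  have hxr : (x : ℝ) ≤ ((i + 1 : ℕ) : ℝ) / (N + 1) := by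
    rw [le_div_iff₀ hN0]
    push_cast
    exact hfl'.le
  have hgap : ((i + 1 : ℕ) : ℝ) / (N + 1) = (i : ℝ) / (N + 1) + 1 / (N + 1) := by
    push_cast
    ring
  have hbl : ((b n ⟨_, hmem ⟨i, by omega⟩⟩ : unitInterval) : ℝ) ≤ b n x := (b n).monotone hxl
  have hbr : (b n x : ℝ) ≤ b n ⟨_, hmem ⟨i + 1, by omega⟩⟩ := (b n).monotone hxr
  rw [abs_lt] at hl hr ⊢
  simp only at hl hr
  constructor <;> linarith [hl.1, hl.2, hr.1, hr.2]

end Uniform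

section Noncentral

lemma conj_pow_mem {Γ A : Subgroup HomeoI} (hnorm : ∀ f ∈ Γ, ∀ a ∈ A, f * a * f⁻¹ ∈ A)
    {f a : HomeoI} (hf : f ∈ Γ) (ha : a ∈ A) (n : ℕ) : f⁻¹ ^ n * a * f ^ n ∈ A := by
  have := hnorm _ (Γ.pow_mem (Γ.inv_mem hf) n) a ha
  rwa [← inv_pow, inv_inv] at this

lemma fix_of_normal {Γ A : Subgroup HomeoI} (hω : ∀ f ∈ Γ, IsAnalytic f) (hA : A ≤ Γ)
    (hcomm : ∀ a ∈ A, ∀ b ∈ A, Commute a b) (hnorm : ∀ f ∈ Γ, ∀ a ∈ A, f * a * f⁻¹ ∈ A)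
    {f a : HomeoI} (hf : f ∈ Γ) (ha : a ∈ A) (hne : a ≠ 1) {x : unitInterval} (hx : a x = x) :
    f x = x := by
  have hfin := finite_fix (hω a (hA ha)) hne
  have hmem : f⁻¹ * a * f ∈ A := by simpa using conj_pow_mem hnorm hf ha 1
  refine fixes_of_finite hfin (fun y hy => ?_) hx
  have h1 : (f⁻¹ * a * f) y = y := fix_of_commute hfin (hcomm _ hmem a ha) hy
  have h2 : f (f⁻¹ (a (f y))) = f y := congrArg f h1
  rwa [apply_inv_self'] at h2

/-- Conjugates of `a` by the iterates of `f` converge to the identity near `q`. -/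
def ConjTendsto (f a : HomeoI) (q : unitInterval) : Prop :=
  ∀ᶠ x in 𝓝 q, Tendsto (fun n : ℕ => (f⁻¹ ^ n * a * f ^ n) x) atTop (𝓝 x)

lemma conjTendsto_or {Γ A : Subgroup HomeoI} (hω : ∀ f ∈ Γ, IsAnalytic f) (hA : A ≤ Γ)
    (hcomm : ∀ a ∈ A, ∀ b ∈ A, Commute a b) (hnorm : ∀ f ∈ Γ, ∀ a ∈ A, f * a * f⁻¹ ∈ A)
    {f a : HomeoI} (hf : f ∈ Γ) (ha : a ∈ A) (hne : ¬ Commute f a)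
    {q : unitInterval} (hq0 : q ≠ 0) (haq : a q = q) :
    ConjTendsto f a q ∨ ConjTendsto f⁻¹ a q := by
  have hane : a ≠ 1 := by rintro rfl; exact hne (Commute.one_right f)
  have hf' := Γ.inv_mem hf
  have hfq := fix_of_normal hω hA hcomm hnorm hf ha hane haq
  have hmem : f⁻¹ * a * f ∈ A := by simpa using conj_pow_mem hnorm hf ha 1
  obtain ⟨k, hk, c, hc, h⟩ := exists_order (hω a (hA ha)) hane haq
  obtain ⟨μ, hμ⟩ := (hω f hf).exists_hasMult q
  have hpow := mult_pow_ne hω hf (hA ha) (hcomm a ha _ hmem) hne hq0 haq hfq hμ hc h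
  have hμ1 : μ ≠ 1 := by rintro rfl; simp at hpow
  have hk2 : 2 ≤ k := by
    rcases hk.lt_or_eq with h | rfl
    · exact h
    · simp at hpow
  have hbig : (fun x : unitInterval => (a x : ℝ) - x) =O[𝓝 q] fun x => ((x : ℝ) - q) ^ 2 := by
    refine (isBigO_of_order h).trans (IsBigO.of_bound 1 (Eventually.of_forall fun x => ?_))
    rw [one_mul, norm_pow, norm_pow]
    refine pow_le_pow_of_le_one (norm_nonneg _) ?_ hk2
    rw [Real.norm_eq_abs, abs_le]
    constructor <;> linarith [x.2.1, x.2.2, q.2.1, q.2.2]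
  obtain ⟨hμ0, hν⟩ := hμ.inv hfq (hω _ hf')
  rcases lt_or_gt_of_ne hμ1 with hlt | hgt
  · exact Or.inl (eventually_tendsto_conj (hω _ hf') hfq hμ hlt hbig)
  · exact Or.inr (eventually_tendsto_conj (by rw [inv_inv]; exact hω f hf) (inv_fix hfq) hν
      (inv_lt_one_of_one_lt₀ hgt) hbig)

lemma ConjTendsto.tendsto {Γ A : Subgroup HomeoI}
    (hcomm : ∀ a ∈ A, ∀ b ∈ A, Commute a b) (hnorm : ∀ f ∈ Γ, ∀ a ∈ A, f * a * f⁻¹ ∈ A)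
    {f a : HomeoI} (hf : f ∈ Γ) (ha : a ∈ A) {q x : unitInterval} (h : ConjTendsto f a q)
    (hx : q ∈ closure (Set.range fun n : ℤ => (a ^ n) x)) :
    Tendsto (fun n : ℕ => (f⁻¹ ^ n * a * f ^ n) x) atTop (𝓝 x) := by
  obtain ⟨_, ⟨j, rfl⟩, hj⟩ := ((mem_closure_iff_frequently.1 hx).and_eventually h).exists
  have h1 := ((a ^ (-j)).continuous.tendsto _).comp hj
  have hinv : ∀ y, (a ^ (-j)) ((a ^ j) y) = y := fun y => by
    rw [← mul_apply', ← zpow_add, neg_add_cancel, zpow_zero, one_apply']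
  simp only [hinv] at h1
  refine h1.congr fun n => ?_
  have hc : Commute (f⁻¹ ^ n * a * f ^ n) (a ^ j) :=
    (hcomm _ (conj_pow_mem hnorm hf ha n) a ha).zpow_right j
  rw [Function.comp_apply, commute_apply hc, hinv]

lemma not_tendsto_both {Γ A : Subgroup HomeoI} (hω : ∀ f ∈ Γ, IsAnalytic f) (hA : A ≤ Γ)
    (hcomm : ∀ a ∈ A, ∀ b ∈ A, Commute a b) (hnorm : ∀ f ∈ Γ, ∀ a ∈ A, f * a * f⁻¹ ∈ A)
    {f a : HomeoI} (hf : f ∈ Γ) (ha : a ∈ A) {x : unitInterval} (hx : a x ≠ x)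
    (h1 : Tendsto (fun n : ℕ => (f⁻¹ ^ n * a * f ^ n) x) atTop (𝓝 x))
    (h2 : Tendsto (fun n : ℕ => (f⁻¹⁻¹ ^ n * a * f⁻¹ ^ n) x) atTop (𝓝 x)) : False := by
  have key : ∀ n : ℕ, ((f⁻¹⁻¹ ^ n * a * f⁻¹ ^ n)⁻¹ * a) ∈ A := fun n =>
    A.mul_mem (A.inv_mem (conj_pow_mem hnorm (Γ.inv_mem hf) ha n)) ha
  have hfix : ∀ n : ℕ, (f⁻¹⁻¹ ^ n * a * f⁻¹ ^ n)⁻¹ * a ≠ 1 →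
      ∀ y, ((f⁻¹⁻¹ ^ n * a * f⁻¹ ^ n)⁻¹ * a) y = y → (f ^ n) y = y := fun n hne y hy =>
    pow_fix (fix_of_normal hω hA hcomm hnorm hf (key n) hne hy) n
  have hconj : ∀ n : ℕ, (f⁻¹⁻¹ ^ n * a * f⁻¹ ^ n) ((f ^ n) x) = (f ^ n) (a x) := fun n => by
    rw [inv_inv, mul_apply', inv_pow, inv_apply_self', mul_apply']
  have hconj' : ∀ n : ℕ, (f⁻¹ ^ n * a * f ^ n) x = (f ^ n)⁻¹ (a ((f ^ n) x)) := fun n => by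
    rw [inv_pow]; rfl
  rcases lt_or_gt_of_ne hx with hlt | hgt
  · obtain ⟨n, hn1, hn2⟩ := ((h1.eventually (lt_mem_nhds hlt)).and
      (h2.eventually (lt_mem_nhds hlt))).exists
    set c := f⁻¹⁻¹ ^ n * a * f⁻¹ ^ n with hc
    have hg : (c⁻¹ * a) x < x := by
      have := (c⁻¹).strictMono hn2
      rwa [inv_apply_self'] at this
    have hg' := apply_lt_of_lt (hfix n (by intro h; rw [h] at hg; exact lt_irrefl _ hg)) hg
    have h3 : c (c⁻¹ (a ((f ^ n) x))) < c ((f ^ n) x) := c.strictMono hg'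
    rw [apply_inv_self', hconj n] at h3
    have h4 := ((f ^ n)⁻¹).strictMono h3
    rw [inv_apply_self', ← hconj'] at h4
    exact lt_asymm h4 hn1
  · obtain ⟨n, hn1, hn2⟩ := ((h1.eventually (gt_mem_nhds hgt)).and
      (h2.eventually (gt_mem_nhds hgt))).exists
    set c := f⁻¹⁻¹ ^ n * a * f⁻¹ ^ n with hc
    have hg : x < (c⁻¹ * a) x := by
      have := (c⁻¹).strictMono hn2
      rwa [inv_apply_self'] at this
    have hg' := lt_apply_of_lt (hfix n (by intro h; rw [h] at hg; exact lt_irrefl _ hg)) hg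
    have h3 : c ((f ^ n) x) < c (c⁻¹ (a ((f ^ n) x))) := c.strictMono hg'
    rw [apply_inv_self', hconj n] at h3
    have h4 := ((f ^ n)⁻¹).strictMono h3
    rw [inv_apply_self', ← hconj'] at h4
    exact lt_asymm h4 hn1

/-- The convergence of the conjugates near the fixed point `1` propagates to all fixed points. -/
lemma conjTendsto_of_one {Γ A : Subgroup HomeoI} (hω : ∀ f ∈ Γ, IsAnalytic f) (hA : A ≤ Γ)
    (hcomm : ∀ a ∈ A, ∀ b ∈ A, Commute a b) (hnorm : ∀ f ∈ Γ, ∀ a ∈ A, f * a * f⁻¹ ∈ A)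
    {f a : HomeoI} (hf : f ∈ Γ) (ha : a ∈ A) (hne : ¬ Commute f a) (hone : ConjTendsto f a 1)
    {q : unitInterval} (hq0 : q ≠ 0) (haq : a q = q) : ConjTendsto f a q := by
  by_contra hq
  have hane : a ≠ 1 := by rintro rfl; exact hne (Commute.one_right f)
  have hfin := finite_fix (hω a (hA ha)) hane
  have hS : {p | a p = p ∧ p ≠ 0 ∧ ¬ ConjTendsto f a p}.Finite := hfin.subset fun p hp => hp.1
  obtain ⟨p, ⟨hap, hp0, hp⟩, hpmax⟩ := Set.exists_max_image _ id hS ⟨q, haq, hq0, hq⟩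
  have hp1 : p < 1 := lt_of_le_of_ne unitInterval.le_one' (by rintro rfl; exact hp hone)
  have hT : {p' | a p' = p' ∧ p < p'}.Finite := hfin.subset fun p hp => hp.1
  obtain ⟨p', ⟨hap', hpp'⟩, hpmin⟩ := Set.exists_min_image _ id hT ⟨1, a.map_top, hp1⟩
  have hp'0 : p' ≠ 0 := (unitInterval.nonneg'.trans_lt hpp').ne'
  have hp' : ConjTendsto f a p' := by
    by_contra h
    exact absurd (hpmax p' ⟨hap', hp'0, h⟩) (not_le.2 hpp')
  obtain ⟨x, hxp', hxa, hx⟩ := exists_lt_of_finite hfin (apply_zero a) hp'0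
  obtain ⟨i, hai, hglb⟩ := exists_fix_isGLB_orbit a x
  have hpi : p ≤ i := hglb.2 (by
    rintro _ ⟨n, rfl⟩
    have := (a ^ n).monotone (hx p hap hpp').le
    rwa [zpow_fix hap] at this)
  have hix : i ≤ x := hglb.1 ⟨0, rfl⟩
  have hip : i = p := by
    by_contra h
    exact absurd ((hpmin i ⟨hai, lt_of_le_of_ne hpi (Ne.symm h)⟩).trans hix) (not_le.2 hxp')
  subst hip
  have hp2 := (conjTendsto_or hω hA hcomm hnorm hf ha hne hp0 hap).resolve_left hp
  exact not_tendsto_both hω hA hcomm hnorm hf ha hxa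
    (hp'.tendsto hcomm hnorm hf ha
      ((isLUB_orbit hap' hxp' hx).mem_closure (Set.range_nonempty _)))
    (hp2.tendsto hcomm hnorm (Γ.inv_mem hf) ha (hglb.mem_closure (Set.range_nonempty _)))

lemma not_c0Discrete_of_conjTendsto {Γ A : Subgroup HomeoI} (hω : ∀ f ∈ Γ, IsAnalytic f)
    (hA : A ≤ Γ) (hcomm : ∀ a ∈ A, ∀ b ∈ A, Commute a b)
    (hnorm : ∀ f ∈ Γ, ∀ a ∈ A, f * a * f⁻¹ ∈ A)
    {f a : HomeoI} (hf : f ∈ Γ) (ha : a ∈ A) (hne : ¬ Commute f a) (hone : ConjTendsto f a 1) :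
    ¬ C0Discrete Γ := by
  rintro ⟨ε, hε, hdisc⟩
  have hane : a ≠ 1 := by rintro rfl; exact hne (Commute.one_right f)
  have hlim : ∀ x, Tendsto (fun n : ℕ => (f⁻¹ ^ n * a * f ^ n) x) atTop (𝓝 x) := by
    intro x
    by_cases hx : a x = x
    · refine tendsto_const_nhds.congr fun n => ?_
      have hfx := fix_of_normal hω hA hcomm hnorm hf ha hane hx
      rw [mul_apply', mul_apply', pow_fix hfx, hx, pow_fix (inv_fix hfx)]
    · obtain ⟨s, has, hlub⟩ := exists_fix_isLUB_orbit a x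
      have hxs : x ≤ s := hlub.1 ⟨0, rfl⟩
      have hs0 : s ≠ 0 := by
        rintro rfl
        exact hx (by rw [le_antisymm hxs unitInterval.nonneg', apply_zero])
      exact (conjTendsto_of_one hω hA hcomm hnorm hf ha hne hone hs0 has).tendsto hcomm hnorm hf ha
        (hlub.mem_closure (Set.range_nonempty _))
  obtain ⟨n, hn⟩ := (eventually_forall_abs_lt hlim hε).exists
  obtain ⟨x, hx⟩ := hdisc _ (hA (conj_pow_mem hnorm hf ha n)) (by
    intro h
    apply hane
    rw [inv_pow, mul_assoc, inv_mul_eq_one] at h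
    exact mul_eq_right.1 h.symm)
  exact absurd (hn x) (not_lt.2 hx)

end Noncentral

/-- A solvable non-Abelian subgroup of `Diff^ω₊(I)` is never `C⁰`-discrete. -/
theorem solvable_nonabelian_not_C0Discrete (Γ : Subgroup HomeoI)
    (hω : ∀ f ∈ Γ, IsAnalytic f)
    (hsol : IsSolvable ↥Γ)
    (hna : ¬ ∀ a ∈ Γ, ∀ b ∈ Γ, a * b = b * a) :
    ¬ C0Discrete Γ := by
  obtain ⟨A, hA, hcomm, hnorm, f, hf, a, ha, hne⟩ := exists_noncentral hω hsol hna
  rcases conjTendsto_or hω hA hcomm hnorm hf ha hne one_ne_zero a.map_top with h | h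
  · exact not_c0Discrete_of_conjTendsto hω hA hcomm hnorm hf ha hne h
  · exact not_c0Discrete_of_conjTendsto hω hA hcomm hnorm (Γ.inv_mem hf) ha
      (fun hc => hne (Commute.inv_left_iff.1 hc)) h

end HeightHomeo
end

section
/- There exists an Abelian subgroup of Homeo₊(I) with infinite strict height, i.e. an Abelian subgroup admitting strict towers of arbitrarily large finite cardinality. -/
open Set

namespace HeightHomeo

theorem coe_map_lt_one (f : HomeoI) {x : unitInterval} (hx : (x : ℝ) < 1) : (f x : ℝ) < 1 := by
  have h : f x < f ⊤ := f.strictMono (show (x : ℝ) < 1 from hx)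
  rw [f.map_top] at h
  exact h

/-- The fractional part, as a point of the unit interval. -/
noncomputable def fractI (x : ℝ) : unitInterval :=
  ⟨Int.fract x, Int.fract_nonneg x, (Int.fract_lt_one x).le⟩

/-- The map of the line acting as `f` on each interval `[n, n + 1]`. -/
noncomputable def periodicFun (f : HomeoI) (x : ℝ) : ℝ :=
  ⌊x⌋ + (f (fractI x) : ℝ)

theorem coe_map_fractI_lt_one (f : HomeoI) (x : ℝ) : (f (fractI x) : ℝ) < 1 :=
  coe_map_lt_one f (Int.fract_lt_one x)

theorem floor_periodicFun (f : HomeoI) (x : ℝ) : ⌊periodicFun f x⌋ = ⌊x⌋ := by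
  rw [Int.floor_eq_iff, periodicFun]
  have h0 := (f (fractI x)).2.1
  have h1 := coe_map_fractI_lt_one f x
  constructor <;> linarith

theorem fractI_periodicFun (f : HomeoI) (x : ℝ) : fractI (periodicFun f x) = f (fractI x) := by
  apply Subtype.ext
  change Int.fract (periodicFun f x) = _
  rw [Int.fract, floor_periodicFun, periodicFun]
  ring

theorem periodicFun_mul (f g : HomeoI) (x : ℝ) :
    periodicFun (f * g) x = periodicFun f (periodicFun g x) := by
  conv_rhs => rw [periodicFun, floor_periodicFun, fractI_periodicFun]
  rfl

theorem periodicFun_one (x : ℝ) : periodicFun 1 x = x :=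
  Int.floor_add_fract x

theorem periodicFun_strictMono (f : HomeoI) : StrictMono (periodicFun f) := by
  intro x y hxy
  rcases (Int.floor_mono hxy.le).lt_or_eq with h | h
  · have h1 := coe_map_fractI_lt_one f x
    have h0 := (f (fractI y)).2.1
    have h2 : (⌊x⌋ : ℝ) + 1 ≤ ⌊y⌋ := by exact_mod_cast h
    rw [periodicFun, periodicFun]
    linarith
  · have h3 : fractI x < fractI y := by
      change Int.fract x < Int.fract y
      rw [Int.fract, Int.fract, h]
      linarith
    have h4 : (f (fractI x) : ℝ) < f (fractI y) := f.strictMono h3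
    rw [periodicFun, periodicFun, h]
    linarith

/-- The automorphism of the line acting as `f` on each interval `[n, n + 1]`. -/
noncomputable def periodic (f : HomeoI) : ℝ ≃o ℝ :=
  (periodicFun_strictMono f).orderIsoOfRightInverse _ (periodicFun f⁻¹) fun x => by
    rw [← periodicFun_mul, mul_inv_cancel, periodicFun_one]

theorem periodic_apply (f : HomeoI) (x : ℝ) : periodic f x = periodicFun f x := rfl

theorem periodic_coe (f : HomeoI) (x : unitInterval) : periodic f x = f x := by
  rw [periodic_apply]
  rcases x.2.2.lt_or_eq with h | h
  · have h1 : ⌊(x : ℝ)⌋ = 0 := Int.floor_eq_zero_iff.2 ⟨x.2.1, h⟩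
    have h2 : fractI x = x := Subtype.ext (Int.fract_eq_self.2 ⟨x.2.1, h⟩)
    rw [periodicFun, h1, h2]
    simp
  · have h1 : x = ⊤ := Subtype.ext h
    have h2 : fractI 1 = ⊥ := Subtype.ext Int.fract_one
    rw [h, h1, f.map_top, periodicFun, h2, f.map_bot]
    change ((⌊(1 : ℝ)⌋ : ℤ) : ℝ) + 0 = 1
    simp

theorem periodic_mul (f g : HomeoI) : periodic (f * g) = periodic f * periodic g :=
  OrderIso.ext (funext fun x => periodicFun_mul f g x)

theorem translation_mul_periodic (f : HomeoI) :
    OrderIso.addRight (1 : ℝ) * periodic f = periodic f * OrderIso.addRight (1 : ℝ) := by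
  refine OrderIso.ext (funext fun x => ?_)
  change periodicFun f x + 1 = periodicFun f (x + 1)
  have h : fractI (x + 1) = fractI x := Subtype.ext (Int.fract_add_one x)
  rw [periodicFun, periodicFun, h, Int.floor_add_one]
  push_cast
  ring

/-- An identification of the extended real line with the unit interval. -/
noncomputable def erealIso : EReal ≃o unitInterval :=
  EReal.expOrderIso.trans ENNReal.orderIsoUnitIntervalBirational

/-- The inclusion of the line in the unit interval. -/
noncomputable def lineIncl (x : ℝ) : unitInterval := erealIso (x : EReal)

theorem lineIncl_strictMono : StrictMono lineIncl :=
  erealIso.strictMono.comp EReal.coe_strictMono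

/-- The homeomorphism of the unit interval extending an automorphism of the line. -/
noncomputable def extend (h : ℝ ≃o ℝ) : HomeoI :=
  erealIso.symm.trans ((h.withTopCongr.withBotCongr : EReal ≃o EReal).trans erealIso)

theorem extend_lineIncl (h : ℝ ≃o ℝ) (x : ℝ) : extend h (lineIncl x) = lineIncl (h x) := by
  change erealIso ((h.withTopCongr.withBotCongr : EReal ≃o EReal)
    (erealIso.symm (erealIso (x : EReal)))) = _
  rw [OrderIso.symm_apply_apply]
  rfl

theorem homeo_ext {f g : HomeoI} (h : ∀ x, f (lineIncl x) = g (lineIncl x)) : f = g := by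
  refine OrderIso.ext (funext fun y => ?_)
  obtain ⟨x, rfl⟩ := erealIso.surjective y
  induction x with
  | bot => rw [OrderIso.map_bot, OrderIso.map_bot, OrderIso.map_bot]
  | coe x => exact h x
  | top => rw [OrderIso.map_top, OrderIso.map_top, OrderIso.map_top]

theorem extend_mul (h k : ℝ ≃o ℝ) : extend (h * k) = extend h * extend k := by
  refine homeo_ext fun x => ?_
  change _ = extend h (extend k (lineIncl x))
  rw [extend_lineIncl, extend_lineIncl, extend_lineIncl]
  rfl

/-- The extension to the unit interval of the unit translation of the line. -/
noncomputable def translation : HomeoI := extend (OrderIso.addRight (1 : ℝ))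

/-- The endomorphism of `Homeo₊(I)` copying `f` into each fundamental domain of `translation`. -/
noncomputable def spread : HomeoI →* HomeoI :=
  MonoidHom.mk' (fun f => extend (periodic f)) fun f g => by rw [periodic_mul, extend_mul]

theorem commute_translation_spread (f : HomeoI) : Commute translation (spread f) := by
  change extend _ * extend _ = extend _ * extend _
  rw [← extend_mul, ← extend_mul, translation_mul_periodic]

/-- The embedding of the unit interval onto a fundamental domain of `translation`. -/
noncomputable def domainIncl (x : unitInterval) : unitInterval := lineIncl x

theorem domainIncl_strictMono : StrictMono domainIncl :=
  fun _ _ h => lineIncl_strictMono h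

theorem spread_domainIncl (f : HomeoI) (x : unitInterval) :
    spread f (domainIncl x) = domainIncl (f x) := by
  change extend _ (lineIncl x) = lineIncl (f x)
  rw [extend_lineIncl, periodic_coe]

/-- The commuting homeomorphisms obtained from `translation` by iterating `spread`. -/
noncomputable def gen (k : ℕ) : HomeoI := spread^[k] translation

theorem commute_gen_add (i j : ℕ) : Commute (gen i) (gen (i + j)) := by
  induction i with
  | zero =>
    cases j with
    | zero => exact Commute.refl _
    | succ j =>
      rw [zero_add, gen, gen, Function.iterate_succ_apply']
      exact commute_translation_spread _
  | succ i ih =>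
    rw [Nat.succ_add, gen, gen, Function.iterate_succ_apply', Function.iterate_succ_apply']
    exact ih.map spread

theorem commute_gen (i j : ℕ) : Commute (gen i) (gen j) := by
  rcases le_total i j with h | h
  · simpa [Nat.add_sub_cancel' h] using commute_gen_add i (j - i)
  · simpa [Nat.add_sub_cancel' h] using (commute_gen_add j (i - j)).symm

theorem translation_zpow_lineIncl (n : ℤ) (x : ℝ) :
    (translation ^ n) (lineIncl x) = lineIncl (x + n) := by
  have step (y : ℝ) : translation (lineIncl y) = lineIncl (y + 1) := extend_lineIncl _ y
  induction n using Int.induction_on with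
  | zero =>
    rw [zpow_zero, Int.cast_zero, add_zero]
    rfl
  | succ n ih =>
    rw [add_comm, zpow_add, zpow_one]
    change translation ((translation ^ (n : ℤ)) (lineIncl x)) = _
    rw [ih, step]
    push_cast
    congr 1
    ring
  | pred n ih =>
    apply translation.injective
    change (translation * translation ^ (-(n : ℤ) - 1)) (lineIncl x) = _
    rw [← zpow_one_add, add_sub_cancel, ih, step]
    push_cast
    congr 1
    ring

/-- The points of the orbit under `gen k` of its basepoint. -/
noncomputable def orbitPt (k : ℕ) (n : ℤ) : unitInterval := domainIncl^[k] (lineIncl n)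

theorem gen_zpow_orbitPt (k : ℕ) (n : ℤ) : (gen k ^ n) (orbitPt k 0) = orbitPt k n := by
  induction k with
  | zero =>
    change (translation ^ n) (lineIncl ((0 : ℤ) : ℝ)) = lineIncl n
    rw [translation_zpow_lineIncl, Int.cast_zero, zero_add]
  | succ k ih =>
    rw [gen, orbitPt, orbitPt, Function.iterate_succ_apply', Function.iterate_succ_apply',
      Function.iterate_succ_apply', ← map_zpow, spread_domainIncl]
    exact congrArg domainIncl ih

theorem orbitPt_strictMono (k : ℕ) : StrictMono (orbitPt k) :=
  (domainIncl_strictMono.iterate k).comp (lineIncl_strictMono.comp Int.cast_strictMono)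

theorem orbitPt_succ_mem_Icc (k : ℕ) (n : ℤ) :
    orbitPt (k + 1) n ∈ Icc (orbitPt k 0) (orbitPt k 1) := by
  change domainIncl^[k] (domainIncl (lineIncl n)) ∈ _
  have hm := (domainIncl_strictMono.iterate k).monotone
  refine ⟨hm (lineIncl_strictMono.monotone ?_), hm (lineIncl_strictMono.monotone ?_)⟩
  · simpa using (lineIncl n).2.1
  · simpa using (lineIncl n).2.2

/-- The orbital of `gen k` spanned by the points `orbitPt k n`. -/
def genOrbital (k : ℕ) : Set unitInterval := ordHull (range (orbitPt k))

theorem orbitPt_mem_genOrbital (k : ℕ) (n : ℤ) : orbitPt k n ∈ genOrbital k :=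
  ⟨_, mem_range_self n, _, mem_range_self n, le_rfl, le_rfl⟩

theorem isOrbitalOf_genOrbital (k : ℕ) : IsOrbitalOf (gen k) (genOrbital k) := by
  refine ⟨orbitPt k 0, ?_, ?_⟩
  · simp only [gen_zpow_orbitPt]
    rfl
  · exact ⟨_, orbitPt_mem_genOrbital k 0, _, orbitPt_mem_genOrbital k 1,
      (orbitPt_strictMono k zero_lt_one).ne⟩

theorem genOrbital_succ_subset_Icc (k : ℕ) :
    genOrbital (k + 1) ⊆ Icc (orbitPt k 0) (orbitPt k 1) := by
  rintro y ⟨_, ⟨m, rfl⟩, _, ⟨n, rfl⟩, hm, hn⟩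
  exact ⟨(orbitPt_succ_mem_Icc k m).1.trans hm, hn.trans (orbitPt_succ_mem_Icc k n).2⟩

theorem genOrbital_antitone : Antitone genOrbital :=
  antitone_nat_of_succ_le fun k _ hy =>
    ⟨_, mem_range_self 0, _, mem_range_self 1, genOrbital_succ_subset_Icc k hy⟩

theorem leftEnd_genOrbital_strictMono : StrictMono fun k => leftEnd (genOrbital k) := by
  refine strictMono_nat_of_lt_succ fun k => ?_
  calc leftEnd (genOrbital k) ≤ orbitPt k (-1) :=
        csInf_le ⟨0, by rintro _ ⟨x, _, rfl⟩; exact x.2.1⟩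
          (mem_image_of_mem _ (orbitPt_mem_genOrbital k (-1)))
    _ < orbitPt k 0 := orbitPt_strictMono k (by norm_num)
    _ ≤ leftEnd (genOrbital (k + 1)) :=
        le_csInf ⟨_, mem_image_of_mem _ (orbitPt_mem_genOrbital (k + 1) 0)⟩ (by
          rintro _ ⟨x, hx, rfl⟩
          exact (genOrbital_succ_subset_Icc k hx).1)

theorem rightEnd_genOrbital_strictAnti : StrictAnti fun k => rightEnd (genOrbital k) := by
  refine strictAnti_nat_of_succ_lt fun k => ?_
  calc rightEnd (genOrbital (k + 1)) ≤ orbitPt k 1 :=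
        csSup_le ⟨_, mem_image_of_mem _ (orbitPt_mem_genOrbital (k + 1) 0)⟩ (by
          rintro _ ⟨x, hx, rfl⟩
          exact (genOrbital_succ_subset_Icc k hx).2)
    _ < orbitPt k 2 := orbitPt_strictMono k (by norm_num)
    _ ≤ rightEnd (genOrbital k) :=
        le_csSup ⟨1, by rintro _ ⟨x, _, rfl⟩; exact x.2.2⟩
          (mem_image_of_mem _ (orbitPt_mem_genOrbital k 2))

theorem genOrbital_injective : Function.Injective genOrbital :=
  fun _ _ h => leftEnd_genOrbital_strictMono.injective (congrArg leftEnd h)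

/-- The infinite strict tower formed by the orbitals `genOrbital k`. -/
noncomputable def genTower : Set (Set unitInterval × HomeoI) :=
  range fun k => (genOrbital k, gen k)

theorem isStrictTower_genTower : IsStrictTower (Subgroup.closure (range gen)) genTower := by
  refine ⟨⟨?_, ?_, ?_⟩, ?_⟩
  · rintro _ ⟨k, rfl⟩
    exact ⟨Subgroup.subset_closure (mem_range_self k), isOrbitalOf_genOrbital k⟩
  · rintro _ ⟨i, rfl⟩ _ ⟨j, rfl⟩
    exact (le_total i j).symm.imp (fun h => genOrbital_antitone h) fun h => genOrbital_antitone h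
  · rintro _ ⟨i, rfl⟩ _ ⟨j, rfl⟩ h
    rw [genOrbital_injective h]
  · rintro _ ⟨i, rfl⟩ _ ⟨j, rfl⟩ hne (h | h)
    · exact hne (congrArg genOrbital (leftEnd_genOrbital_strictMono.injective h))
    · exact hne (congrArg genOrbital (rightEnd_genOrbital_strictAnti.injective h))

theorem encard_towerOrbitals_genTower : (towerOrbitals genTower).encard = ⊤ := by
  rw [encard_eq_top_iff, towerOrbitals, genTower, ← range_comp]
  exact infinite_range_of_injective genOrbital_injective

/-- There exists an Abelian subgroup of `Homeo₊(I)` with infinite strict height. -/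
theorem exists_abelian_infinite_strictHeight :
    ∃ Γ : Subgroup HomeoI,
      (∀ a ∈ Γ, ∀ b ∈ Γ, a * b = b * a) ∧ strictHeight Γ = ⊤ := by
  refine ⟨Subgroup.closure (range gen), fun a ha b hb => ?_, ?_⟩
  · induction ha, hb using Subgroup.closure_induction₂ with
    | mem x y hx hy =>
      obtain ⟨i, rfl⟩ := hx
      obtain ⟨j, rfl⟩ := hy
      exact commute_gen i j
    | one_left x _ => exact Commute.one_left x
    | one_right x _ => exact Commute.one_right x
    | mul_left x y z _ _ _ h1 h2 => exact Commute.mul_left h1 h2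
    | mul_right y z x _ _ _ h1 h2 => exact Commute.mul_right h1 h2
    | inv_left x y _ _ h => exact Commute.inv_left h
    | inv_right x y _ _ h => exact Commute.inv_right h
  · rw [← top_le_iff, ← encard_towerOrbitals_genTower]
    exact le_iSup₂ (f := fun T _ => (towerOrbitals T).encard) genTower isStrictTower_genTower

end HeightHomeo
end
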